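/- arXiv:1810.06188 — 8 statements merged into one kernel-verified Lean document; each statement's English description precedes it below -/
import Mathlib

section
/- Fix an integer k ≥ 1. Let (N_l) be a sequence of norms on ℝ^k that is Cauchy with respect to d, i.e., for every ε > 0 there exists L such that d(N_l, N_m) < ε for all l, m ≥ L. Then there exists a norm N on ℝ^k such that d(N_l, N) → 0 as l → ∞. (In other words, the pseudometric space of norms on ℝ^k under d is complete.) -/
/-- A norm on `ℝ^k`. -/
def IsNormOn {k : ℕ} (N : (Fin k → ℝ) → ℝ) : Prop :=
  (∀ x, 0 ≤ N x) ∧ (∀ x, N x = 0 ↔ x = 0) ∧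
  (∀ (c : ℝ) (x), N (c • x) = |c| * N x) ∧
  (∀ x y, N (x + y) ≤ N x + N y)

/-- The set of ratios `N' x / N x` over nonzero `x`. -/
def ratioSet {k : ℕ} (N N' : (Fin k → ℝ) → ℝ) : Set ℝ :=
  {r | ∃ x : Fin k → ℝ, x ≠ 0 ∧ r = N' x / N x}

/-- `d(N, N') = log (M(N,N') / m(N,N'))`. -/
noncomputable def normDist {k : ℕ} (N N' : (Fin k → ℝ) → ℝ) : ℝ :=
  Real.log (sSup (ratioSet N N') / sInf (ratioSet N N'))

namespace IsNormOn

variable {k : ℕ} {N N' : (Fin k → ℝ) → ℝ}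

lemma pos (h : IsNormOn N) {x : Fin k → ℝ} (hx : x ≠ 0) : 0 < N x :=
  lt_of_le_of_ne (h.1 x) fun h0 => hx ((h.2.1 x).1 h0.symm)

lemma map_sum_le (h : IsNormOn N) {ι : Type*} (s : Finset ι) (f : ι → Fin k → ℝ) :
    N (∑ i ∈ s, f i) ≤ ∑ i ∈ s, N (f i) :=
  Finset.le_sum_of_subadditive N ((h.2.1 0).2 rfl).le h.2.2.2 s f

lemma exists_le_mul_norm (h : IsNormOn N) : ∃ C, 0 < C ∧ ∀ x, N x ≤ C * ‖x‖ := by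
  refine ⟨∑ i, N (Pi.single i 1) + 1,
    add_pos_of_nonneg_of_pos (Finset.sum_nonneg fun i _ => h.1 _) one_pos, fun x => ?_⟩
  have hx : x = ∑ i, x i • (Pi.single i 1 : Fin k → ℝ) := pi_eq_sum_univ' x
  calc N x = N (∑ i, x i • (Pi.single i 1 : Fin k → ℝ)) := congrArg N hx
    _ ≤ ∑ i, N (x i • (Pi.single i 1 : Fin k → ℝ)) := h.map_sum_le _ _
    _ ≤ ∑ i, N (Pi.single i 1) * ‖x‖ := by
        refine Finset.sum_le_sum fun i _ => ?_
        rw [h.2.2.1, mul_comm]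
        exact mul_le_mul_of_nonneg_left (norm_le_pi_norm x i) (h.1 _)
    _ ≤ (∑ i, N (Pi.single i 1) + 1) * ‖x‖ := by
        rw [← Finset.sum_mul]
        nlinarith [norm_nonneg x]

lemma continuous (h : IsNormOn N) : Continuous N := by
  obtain ⟨C, hC, hle⟩ := h.exists_le_mul_norm
  refine (LipschitzWith.of_le_add_mul C.toNNReal fun x y => ?_).continuous
  rw [Real.coe_toNNReal _ hC.le, dist_eq_norm]
  calc N x = N (y + (x - y)) := by rw [add_sub_cancel]
    _ ≤ N y + N (x - y) := h.2.2.2 _ _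
    _ ≤ N y + C * ‖x - y‖ := by gcongr; exact hle _

lemma exists_mul_norm_le (h : IsNormOn N) : ∃ c, 0 < c ∧ ∀ x, c * ‖x‖ ≤ N x := by
  obtain ⟨c, hc, hle⟩ := (isCompact_sphere (0 : Fin k → ℝ) 1).exists_forall_le'
    h.continuous.continuousOn (a := 0) fun x hx => h.pos (ne_zero_of_mem_unit_sphere ⟨x, hx⟩)
  refine ⟨c, hc, fun x => ?_⟩
  rcases eq_or_ne x 0 with rfl | hx
  · simpa using h.1 0
  · have hn : 0 < ‖x‖ := norm_pos_iff.2 hx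
    have := hle (‖x‖⁻¹ • x) (by simp [norm_smul, hn.ne'])
    rw [h.2.2.1, abs_of_pos (inv_pos.2 hn), inv_mul_eq_div, le_div_iff₀ hn] at this
    exact this

lemma exists_ratio_bounds (h : IsNormOn N) (h' : IsNormOn N') :
    ∃ a b, 0 < a ∧ ∀ x, x ≠ 0 → a ≤ N' x / N x ∧ N' x / N x ≤ b := by
  obtain ⟨C, hC, hNC⟩ := h.exists_le_mul_norm
  obtain ⟨c, hc, hNc⟩ := h.exists_mul_norm_le
  obtain ⟨C', hC', hNC'⟩ := h'.exists_le_mul_norm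
  obtain ⟨c', hc', hNc'⟩ := h'.exists_mul_norm_le
  refine ⟨c' / C, C' / c, div_pos hc' hC, fun x hx => ⟨?_, ?_⟩⟩
  · rw [div_le_div_iff₀ hC (h.pos hx)]
    nlinarith [mul_le_mul_of_nonneg_left (hNC x) hc'.le,
      mul_le_mul_of_nonneg_left (hNc' x) hC.le]
  · rw [div_le_div_iff₀ (h.pos hx) hc]
    nlinarith [mul_le_mul_of_nonneg_left (hNc x) hC'.le,
      mul_le_mul_of_nonneg_left (hNC' x) hc.le]

lemma ratio_le_of_normDist_le (h : IsNormOn N) (h' : IsNormOn N') {ε : ℝ}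
    (hd : normDist N N' ≤ ε) {x y : Fin k → ℝ} (hx : x ≠ 0) (hy : y ≠ 0) :
    N' x / N x ≤ Real.exp ε * (N' y / N y) := by
  obtain ⟨a, b, ha, hab⟩ := h.exists_ratio_bounds h'
  have hbdd : BddAbove (ratioSet N N') := ⟨b, by rintro _ ⟨z, hz, rfl⟩; exact (hab z hz).2⟩
  have hbdd' : BddBelow (ratioSet N N') := ⟨a, by rintro _ ⟨z, hz, rfl⟩; exact (hab z hz).1⟩
  have hM : N' x / N x ≤ sSup (ratioSet N N') := le_csSup hbdd ⟨x, hx, rfl⟩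
  have hm : sInf (ratioSet N N') ≤ N' y / N y := csInf_le hbdd' ⟨y, hy, rfl⟩
  have hm0 : 0 < sInf (ratioSet N N') := ha.trans_le <|
    le_csInf ⟨_, x, hx, rfl⟩ (by rintro _ ⟨z, hz, rfl⟩; exact (hab z hz).1)
  have hM0 : 0 < sSup (ratioSet N N') := (ha.trans_le (hab x hx).1).trans_le hM
  have hle := (Real.log_le_iff_le_exp (div_pos hM0 hm0)).1 hd
  rw [div_le_iff₀ hm0] at hle
  exact hM.trans (hle.trans (mul_le_mul_of_nonneg_left hm (Real.exp_pos ε).le))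

lemma normDist_mem_Icc (h : IsNormOn N) (h' : IsNormOn N') {ε : ℝ}
    (hne : ∃ x : Fin k → ℝ, x ≠ 0)
    (hr : ∀ x y : Fin k → ℝ, x ≠ 0 → y ≠ 0 → N' x / N x ≤ Real.exp ε * (N' y / N y)) :
    normDist N N' ∈ Set.Icc 0 ε := by
  obtain ⟨x₀, hx₀⟩ := hne
  obtain ⟨a, b, ha, hab⟩ := h.exists_ratio_bounds h'
  have hmem : N' x₀ / N x₀ ∈ ratioSet N N' := ⟨x₀, hx₀, rfl⟩
  have hbdd : BddAbove (ratioSet N N') := ⟨b, by rintro _ ⟨z, hz, rfl⟩; exact (hab z hz).2⟩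
  have hbdd' : BddBelow (ratioSet N N') := ⟨a, by rintro _ ⟨z, hz, rfl⟩; exact (hab z hz).1⟩
  have hm0 : 0 < sInf (ratioSet N N') := ha.trans_le <|
    le_csInf ⟨_, hmem⟩ (by rintro _ ⟨z, hz, rfl⟩; exact (hab z hz).1)
  have hmM : sInf (ratioSet N N') ≤ sSup (ratioSet N N') := csInf_le_csSup ⟨_, hmem⟩ hbdd' hbdd
  refine ⟨Real.log_nonneg ((one_le_div hm0).2 hmM), ?_⟩
  refine (Real.log_le_iff_le_exp (div_pos (hm0.trans_le hmM) hm0)).2 ?_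
  rw [div_le_iff₀ hm0, mul_comm, ← div_le_iff₀ (Real.exp_pos ε)]
  refine le_csInf ⟨_, hmem⟩ ?_
  rintro _ ⟨y, hy, rfl⟩
  rw [div_le_iff₀ (Real.exp_pos ε), mul_comm]
  refine csSup_le ⟨_, hmem⟩ ?_
  rintro _ ⟨x, hx, rfl⟩
  exact hr x y hx hy

lemma of_tendsto {P : ℕ → (Fin k → ℝ) → ℝ} {Q : (Fin k → ℝ) → ℝ}
    (hP : ∀ l, IsNormOn (P l)) (hQ : ∀ x, Filter.Tendsto (fun l => P l x) Filter.atTop (nhds (Q x)))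
    (hpos : ∀ x, x ≠ 0 → 0 < Q x) : IsNormOn Q := by
  have h0 : Q 0 = 0 := tendsto_nhds_unique (hQ 0) <| by
    simp only [fun l => ((hP l).2.1 0).2 rfl, tendsto_const_nhds]
  refine ⟨fun x => ge_of_tendsto' (hQ x) fun l => (hP l).1 x, fun x => ⟨fun hx => ?_, ?_⟩,
    fun c x => ?_, fun x y => ?_⟩
  · by_contra hne
    exact (hpos x hne).ne' hx
  · rintro rfl
    exact h0
  · refine tendsto_nhds_unique (hQ (c • x)) ?_
    simpa only [fun l => (hP l).2.2.1 c x] using (hQ x).const_mul |c|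
  · exact le_of_tendsto_of_tendsto' (hQ _) ((hQ x).add (hQ y)) fun l => (hP l).2.2.2 x y

lemma div_const (h : IsNormOn N) {a : ℝ} (ha : 0 < a) : IsNormOn fun x => N x / a := by
  refine ⟨fun x => div_nonneg (h.1 x) ha.le, fun x => ?_, fun c x => ?_, fun x y => ?_⟩
  · simp [ha.ne', h.2.1]
  · simp only [h.2.2.1, mul_div_assoc]
  · rw [← add_div]
    exact div_le_div_of_nonneg_right (h.2.2.2 x y) ha.le

end IsNormOn

lemma exists_pos_tendsto_of_le_exp_mul {u : ℕ → ℝ} (hu : ∀ l, 0 < u l)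
    (h : ∀ ε : ℝ, 0 < ε → ∃ L : ℕ, ∀ l m : ℕ, L ≤ l → L ≤ m → u m ≤ Real.exp ε * u l) :
    ∃ a, 0 < a ∧ Filter.Tendsto u Filter.atTop (nhds a) := by
  have hlog : CauchySeq fun l => Real.log (u l) := by
    refine Metric.cauchySeq_iff.2 fun ε hε => ?_
    obtain ⟨L, hL⟩ := h (ε / 2) (half_pos hε)
    have key : ∀ l ≥ L, ∀ m ≥ L, Real.log (u m) ≤ ε / 2 + Real.log (u l) := fun l hl m hm => by
      have := Real.log_le_log (hu m) (hL l m hl hm)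
      rwa [Real.log_mul (Real.exp_pos _).ne' (hu l).ne', Real.log_exp] at this
    refine ⟨L, fun m hm l hl => ?_⟩
    rw [Real.dist_eq, abs_lt]
    constructor <;> linarith [key l hl m hm, key m hm l hl]
  obtain ⟨b, hb⟩ := cauchySeq_tendsto_of_complete hlog
  refine ⟨Real.exp b, Real.exp_pos b, ?_⟩
  simpa only [Function.comp_def, Real.exp_log (hu _)] using
    (Real.continuous_exp.tendsto b).comp hb

theorem stmt_2 (k : ℕ) (hk : 1 ≤ k) (N : ℕ → (Fin k → ℝ) → ℝ)
    (hN : ∀ l, IsNormOn (N l))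
    (hCauchy : ∀ ε : ℝ, 0 < ε → ∃ L : ℕ, ∀ l m : ℕ, L ≤ l → L ≤ m →
      normDist (N l) (N m) < ε) :
    ∃ Nlim : (Fin k → ℝ) → ℝ, IsNormOn Nlim ∧
      Filter.Tendsto (fun l => normDist (N l) Nlim) Filter.atTop (nhds 0) := by
  obtain ⟨e, he⟩ : ∃ e : Fin k → ℝ, e ≠ 0 :=
    ⟨fun _ => 1, fun h => one_ne_zero (congrFun h ⟨0, hk⟩)⟩
  have hNe : ∀ l, 0 < N l e := fun l => (hN l).pos he
  have hP : ∀ l, IsNormOn fun x => N l x / N l e := fun l => (hN l).div_const (hNe l)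
  have hlim : ∀ x, ∃ a, (x ≠ 0 → 0 < a) ∧
      Filter.Tendsto (fun l => N l x / N l e) Filter.atTop (nhds a) := by
    intro x
    rcases eq_or_ne x 0 with rfl | hx
    · refine ⟨0, fun h => absurd rfl h, ?_⟩
      simp only [fun l => ((hN l).2.1 0).2 rfl, zero_div, tendsto_const_nhds]
    · obtain ⟨a, ha, hta⟩ := exists_pos_tendsto_of_le_exp_mul (fun l => (hP l).pos hx)
        fun ε hε => by
          obtain ⟨L, hL⟩ := hCauchy ε hε
          refine ⟨L, fun l m hl hm => ?_⟩
          have := (hN l).ratio_le_of_normDist_le (hN m) (hL l m hl hm).le hx he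
          rw [div_le_iff₀ ((hN l).pos hx)] at this
          rw [div_le_iff₀ (hNe m)]
          exact this.trans_eq (by ring)
      exact ⟨a, fun _ => ha, hta⟩
  choose Q hQpos hQ using hlim
  have hQnorm : IsNormOn Q := .of_tendsto hP hQ hQpos
  refine ⟨Q, hQnorm, Metric.tendsto_atTop.2 fun ε hε => ?_⟩
  obtain ⟨L, hL⟩ := hCauchy (ε / 2) (half_pos hε)
  refine ⟨L, fun l hl => ?_⟩
  have hmem : normDist (N l) Q ∈ Set.Icc 0 (ε / 2) := by
    refine (hN l).normDist_mem_Icc hQnorm ⟨e, he⟩ fun x y hx hy => ?_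
    refine le_of_tendsto_of_tendsto ((hQ x).div_const _)
      (((hQ y).div_const _).const_mul _) ?_
    filter_upwards [Filter.eventually_ge_atTop L] with m hm
    have := (hN l).ratio_le_of_normDist_le (hN m) (hL l m hl hm).le hx hy
    rw [div_right_comm, div_right_comm (N m y), ← mul_div_assoc]
    exact div_le_div_of_nonneg_right this (hNe m).le
  rw [Real.dist_0_eq_abs, abs_of_nonneg hmem.1]
  linarith [hmem.2]
end

section
/- Let X be a nonempty set and let (M, +) be an additive commutative semigroup equipped with a metric d_M that is translation-invariant: d_M(x+z, y+z) = d_M(x,y) for all x, y, z ∈ M. Then D is a pseudometric on the set of bounded functions from X to M: for all bounded f, g, h : X → M, D(f,g) is finite and nonnegative, D(f,f) = 0, D(f,g) = D(g,f), and D(f,g) ≤ D(f,h) + D(h,g). -/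
/-- The set of values `dist (f x + g x') (f x' + g x)`. -/
def DSet {X M : Type*} [AddCommSemigroup M] [MetricSpace M] (f g : X → M) : Set ℝ :=
  {r | ∃ x x' : X, r = dist (f x + g x') (f x' + g x)}

/-- The diameter pseudometric `D(f,g) = sup_{x,x'} dist (f x + g x') (f x' + g x)`. -/
noncomputable def DDist {X M : Type*} [AddCommSemigroup M] [MetricSpace M]
    (f g : X → M) : ℝ :=
  sSup (DSet f g)

section TranslationInvariant

variable {X M : Type*} [AddCommSemigroup M] [MetricSpace M]

theorem dist_add_left_of_translation_invariant
    (hinv : ∀ x y z : M, dist (x + z) (y + z) = dist x y) (x y z : M) :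
    dist (z + x) (z + y) = dist x y := by
  rw [add_comm z x, add_comm z y, hinv]

theorem DSet_comm (f g : X → M) : DSet f g = DSet g f := by
  ext r
  constructor <;>
  · rintro ⟨x, x', rfl⟩
    exact ⟨x', x, by simp only [add_comm]⟩

theorem DDist_comm (f g : X → M) : DDist f g = DDist g f := by
  rw [DDist, DDist, DSet_comm]

theorem DDist_nonneg (f g : X → M) : 0 ≤ DDist f g := by
  refine Real.sSup_nonneg ?_
  rintro _ ⟨x, x', rfl⟩
  exact dist_nonneg

theorem DDist_self (f : X → M) : DDist f f = 0 := by
  refine le_antisymm (Real.sSup_nonpos ?_) (DDist_nonneg f f)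
  rintro _ ⟨x, x', rfl⟩
  rw [add_comm, dist_self]

theorem bddAbove_DSet (hinv : ∀ x y z : M, dist (x + z) (y + z) = dist x y) {f g : X → M}
    (hf : Bornology.IsBounded (Set.range f)) (hg : Bornology.IsBounded (Set.range g)) :
    BddAbove (DSet f g) := by
  obtain ⟨A, hA⟩ := Metric.isBounded_range_iff.1 hf
  obtain ⟨B, hB⟩ := Metric.isBounded_range_iff.1 hg
  refine ⟨A + B, ?_⟩
  rintro _ ⟨x, x', rfl⟩
  calc dist (f x + g x') (f x' + g x)
      ≤ dist (f x + g x') (f x' + g x') + dist (f x' + g x') (f x' + g x) :=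
        dist_triangle _ _ _
    _ = dist (f x) (f x') + dist (g x') (g x) := by
        rw [hinv, dist_add_left_of_translation_invariant hinv]
    _ ≤ A + B := add_le_add (hA x x') (hB x' x)

theorem dist_cross_add_le (hinv : ∀ x y z : M, dist (x + z) (y + z) = dist x y)
    (f g h : X → M) (x x' : X) :
    dist (f x + g x') (f x' + g x) ≤
      dist (f x + h x') (f x' + h x) + dist (h x + g x') (h x' + g x) := by
  calc dist (f x + g x') (f x' + g x)
      = dist (f x + h x' + g x') (f x' + (h x' + g x)) := by
        rw [← hinv _ _ (h x'), add_right_comm, add_assoc (f x'), add_comm (g x)]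
    _ ≤ dist (f x + h x' + g x') (f x' + h x + g x') +
          dist (f x' + h x + g x') (f x' + (h x' + g x)) := dist_triangle _ _ _
    _ = dist (f x + h x') (f x' + h x) + dist (h x + g x') (h x' + g x) := by
        rw [hinv, add_assoc (f x'), dist_add_left_of_translation_invariant hinv]

theorem DDist_triangle (hinv : ∀ x y z : M, dist (x + z) (y + z) = dist x y) {f g h : X → M}
    (hfh : BddAbove (DSet f h)) (hhg : BddAbove (DSet h g)) :
    DDist f g ≤ DDist f h + DDist h g := by
  refine Real.sSup_le ?_ (add_nonneg (DDist_nonneg f h) (DDist_nonneg h g))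
  rintro _ ⟨x, x', rfl⟩
  exact (dist_cross_add_le hinv f g h x x').trans
    (add_le_add (le_csSup hfh ⟨x, x', rfl⟩) (le_csSup hhg ⟨x, x', rfl⟩))

end TranslationInvariant

theorem stmt_5 {X M : Type*} [Nonempty X] [AddCommSemigroup M] [MetricSpace M]
    (hinv : ∀ x y z : M, dist (x + z) (y + z) = dist x y)
    (f g h : X → M)
    (hf : Bornology.IsBounded (Set.range f))
    (hg : Bornology.IsBounded (Set.range g))
    (hh : Bornology.IsBounded (Set.range h)) :
    BddAbove (DSet f g) ∧ 0 ≤ DDist f g ∧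
    DDist f f = 0 ∧ DDist f g = DDist g f ∧
    DDist f g ≤ DDist f h + DDist h g := by
  exact ⟨bddAbove_DSet hinv hf hg, DDist_nonneg f g, DDist_self f, DDist_comm f g,
    DDist_triangle hinv (bddAbove_DSet hinv hf hh) (bddAbove_DSet hinv hh hg)⟩
end

section
/- Fix an integer k ≥ 2 and p ∈ [1,∞]. For q ∈ [0,∞) and j ∈ {1, …, k}, define N_{p,q,j}(x) := ‖x‖_p + q·|x_j| for x ∈ ℝ^k; each N_{p,q,j} is a norm on ℝ^k. Then for all q, q' ∈ [0,∞): (a) for each j, d(N_{p,q,j}, N_{p,q',j}) = |log(1+q') − log(1+q)|; and (b) for j ≠ j', d(N_{p,q,j}, N_{p,q',j'}) = log(1+q) + log(1+q'). (Hence the map N_{p,q,j} ↦ log(1+q)·e_j is an isometric embedding of this family into ℝ^k with the ℓ¹-norm, and in particular the space of norms on ℝ^k modulo positive scaling is unbounded for k ≥ 2.) -/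
open scoped ENNReal BigOperators

/-- The `p`-norm on `ℝ^k`, for `p ∈ [1,∞]`. -/
noncomputable def pNorm {k : ℕ} (p : ℝ≥0∞) (x : Fin k → ℝ) : ℝ :=
  if p = ∞ then ⨆ j, |x j| else (∑ j, |x j| ^ p.toReal) ^ (1 / p.toReal)

/-- The norm `N_{p,q,j}(x) = ‖x‖_p + q·|x_j|`. -/
noncomputable def Npqj {k : ℕ} (p : ℝ≥0∞) (q : ℝ) (j : Fin k) :
    (Fin k → ℝ) → ℝ :=
  fun x => pNorm p x + q * |x j|

theorem pNorm_eq_norm {k : ℕ} {p : ℝ≥0∞} [Fact (1 ≤ p)] (x : Fin k → ℝ) :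
    pNorm p x = ‖WithLp.toLp p x‖ := by
  have hp : 1 ≤ p := Fact.out
  unfold pNorm
  split_ifs with h
  · subst h
    simp [PiLp.norm_eq_ciSup]
  · have hpos : 0 < p.toReal := ENNReal.toReal_pos (one_pos.trans_le hp).ne' h
    simp [PiLp.norm_eq_sum hpos]

theorem abs_apply_le_pNorm {k : ℕ} {p : ℝ≥0∞} (hp : 1 ≤ p) (x : Fin k → ℝ) (j : Fin k) :
    |x j| ≤ pNorm p x := by
  have : Fact (1 ≤ p) := ⟨hp⟩
  rw [pNorm_eq_norm]
  exact PiLp.norm_apply_le (WithLp.toLp p x) j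

theorem pNorm_single_one {k : ℕ} {p : ℝ≥0∞} (hp : 1 ≤ p) (j : Fin k) :
    pNorm p (Pi.single j 1) = 1 := by
  have : Fact (1 ≤ p) := ⟨hp⟩
  rw [pNorm_eq_norm]
  simp

theorem isNormOn_pNorm {k : ℕ} {p : ℝ≥0∞} (hp : 1 ≤ p) :
    IsNormOn (pNorm p : (Fin k → ℝ) → ℝ) := by
  have : Fact (1 ≤ p) := ⟨hp⟩
  refine ⟨fun x => ?_, fun x => ?_, fun c x => ?_, fun x y => ?_⟩
  · rw [pNorm_eq_norm]
    exact norm_nonneg _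
  · rw [pNorm_eq_norm, norm_eq_zero, WithLp.toLp_eq_zero]
  · rw [pNorm_eq_norm, pNorm_eq_norm, WithLp.toLp_smul, norm_smul, Real.norm_eq_abs]
  · rw [pNorm_eq_norm, pNorm_eq_norm, pNorm_eq_norm, WithLp.toLp_add]
    exact norm_add_le _ _

theorem isNormOn_Npqj {k : ℕ} {p : ℝ≥0∞} (hp : 1 ≤ p) {q : ℝ} (hq : 0 ≤ q) (j : Fin k) :
    IsNormOn (Npqj p q j) := by
  obtain ⟨h_nonneg, h_zero, h_smul, h_add⟩ := isNormOn_pNorm (k := k) hp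
  refine ⟨fun x => ?_, fun x => ⟨fun h => ?_, ?_⟩, fun c x => ?_, fun x y => ?_⟩
  · exact add_nonneg (h_nonneg x) (by positivity)
  · have hx : 0 ≤ q * |x j| := by positivity
    exact (h_zero x).1 (le_antisymm (by unfold Npqj at h; linarith) (h_nonneg x))
  · rintro rfl
    simp [Npqj, (h_zero 0).2 rfl]
  · simp only [Npqj, h_smul, Pi.smul_apply, smul_eq_mul, abs_mul]
    ring
  · have hxy := mul_le_mul_of_nonneg_left (abs_add_le (x j) (y j)) hq
    simp only [Npqj, Pi.add_apply]
    linarith [h_add x y]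

theorem Npqj_single_same {k : ℕ} {p : ℝ≥0∞} (hp : 1 ≤ p) (q : ℝ) (j : Fin k) :
    Npqj p q j (Pi.single j 1) = 1 + q := by
  simp [Npqj, pNorm_single_one hp]

theorem Npqj_single_of_ne {k : ℕ} {p : ℝ≥0∞} (hp : 1 ≤ p) (q : ℝ) {i j : Fin k} (h : i ≠ j) :
    Npqj p q j (Pi.single i 1) = 1 := by
  simp [Npqj, pNorm_single_one hp, Pi.single_eq_of_ne h.symm]

/-- If `m * N ≤ N' ≤ M * N` and both bounds are attained, then `d(N, N') = log (M / m)`. -/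
theorem normDist_eq_log_div {k : ℕ} {N N' : (Fin k → ℝ) → ℝ} (hN : IsNormOn N) {m M : ℝ}
    (h_le : ∀ x, N' x ≤ M * N x) (h_ge : ∀ x, m * N x ≤ N' x)
    {u v : Fin k → ℝ} (hu : u ≠ 0) (hv : v ≠ 0) (huM : N' u = M * N u) (hvm : N' v = m * N v) :
    normDist N N' = Real.log (M / m) := by
  have hpos : ∀ x, x ≠ 0 → 0 < N x := fun x hx =>
    (hN.1 x).lt_of_ne fun h => hx ((hN.2.1 x).1 h.symm)
  have hM : IsGreatest (ratioSet N N') M := by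
    refine ⟨⟨u, hu, (eq_div_iff (hpos u hu).ne').2 huM.symm⟩, ?_⟩
    rintro r ⟨x, hx, rfl⟩
    exact (div_le_iff₀ (hpos x hx)).2 (h_le x)
  have hm : IsLeast (ratioSet N N') m := by
    refine ⟨⟨v, hv, (eq_div_iff (hpos v hv).ne').2 hvm.symm⟩, ?_⟩
    rintro r ⟨x, hx, rfl⟩
    exact (le_div_iff₀ (hpos x hx)).2 (h_ge x)
  rw [normDist, hM.csSup_eq, hm.csInf_eq]

theorem Npqj_mono {k : ℕ} (p : ℝ≥0∞) {q q' : ℝ} (h : q ≤ q') (j : Fin k) (x : Fin k → ℝ) :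
    Npqj p q j x ≤ Npqj p q' j x := by
  unfold Npqj
  gcongr

theorem one_add_mul_Npqj_le {k : ℕ} {p : ℝ≥0∞} (hp : 1 ≤ p) {q q' : ℝ} (h : q ≤ q')
    (j : Fin k) (x : Fin k → ℝ) :
    (1 + q) * Npqj p q' j x ≤ (1 + q') * Npqj p q j x := by
  have := mul_le_mul_of_nonneg_left (abs_apply_le_pNorm hp x j) (sub_nonneg.2 h)
  unfold Npqj
  linarith

theorem Npqj_le_one_add_mul {k : ℕ} {p : ℝ≥0∞} (hp : 1 ≤ p) {q q' : ℝ} (hq : 0 ≤ q)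
    (hq' : 0 ≤ q') (j j' : Fin k) (x : Fin k → ℝ) :
    Npqj p q' j' x ≤ (1 + q') * Npqj p q j x := by
  have h₁ := mul_le_mul_of_nonneg_left (abs_apply_le_pNorm hp x j') hq'
  have h₂ : 0 ≤ (1 + q') * (q * |x j|) := by positivity
  unfold Npqj
  linarith

theorem normDist_Npqj_of_ne {k : ℕ} {p : ℝ≥0∞} (hp : 1 ≤ p) {q q' : ℝ} (hq : 0 ≤ q)
    (hq' : 0 ≤ q') {j j' : Fin k} (h : j ≠ j') :
    normDist (Npqj p q j) (Npqj p q' j') = Real.log (1 + q) + Real.log (1 + q') := by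
  have h₁ : 0 < 1 + q := by linarith
  have h₂ : 0 < 1 + q' := by linarith
  rw [normDist_eq_log_div (isNormOn_Npqj hp hq j) (m := (1 + q)⁻¹) (M := 1 + q')
    (u := Pi.single j' 1) (v := Pi.single j 1) (Npqj_le_one_add_mul hp hq hq' j j')
    (fun x => (inv_mul_le_iff₀ h₁).2 (Npqj_le_one_add_mul hp hq' hq j' j x))
    (by simp) (by simp)
    (by rw [Npqj_single_same hp, Npqj_single_of_ne hp _ h.symm, mul_one])
    (by rw [Npqj_single_same hp, Npqj_single_of_ne hp _ h, inv_mul_cancel₀ h₁.ne']),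
    div_inv_eq_mul, Real.log_mul h₂.ne' h₁.ne', add_comm]

theorem normDist_Npqj_same {k : ℕ} (hk : 2 ≤ k) {p : ℝ≥0∞} (hp : 1 ≤ p) {q q' : ℝ} (hq : 0 ≤ q)
    (hq' : 0 ≤ q') (j : Fin k) :
    normDist (Npqj p q j) (Npqj p q' j) = |Real.log (1 + q') - Real.log (1 + q)| := by
  have h₁ : 0 < 1 + q := by linarith
  have h₂ : 0 < 1 + q' := by linarith
  have : Nontrivial (Fin k) := Fin.nontrivial_iff_two_le.2 hk
  obtain ⟨i, hi⟩ := exists_ne j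
  have h_same : Npqj p q' j (Pi.single j 1) = (1 + q') / (1 + q) * Npqj p q j (Pi.single j 1) := by
    rw [Npqj_single_same hp, Npqj_single_same hp, div_mul_cancel₀ _ h₁.ne']
  have h_ne : Npqj p q' j (Pi.single i 1) = 1 * Npqj p q j (Pi.single i 1) := by
    rw [Npqj_single_of_ne hp _ hi, Npqj_single_of_ne hp _ hi, one_mul]
  rcases le_total q q' with h | h
  · rw [normDist_eq_log_div (isNormOn_Npqj hp hq j)
      (fun x => by
        rw [div_mul_eq_mul_div, le_div_iff₀ h₁, mul_comm]
        exact one_add_mul_Npqj_le hp h j x)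
      (fun x => by simpa using Npqj_mono p h j x) (by simp) (by simp) h_same h_ne,
      div_one, Real.log_div h₂.ne' h₁.ne',
      abs_of_nonneg (sub_nonneg.2 (Real.log_le_log h₁ (by linarith)))]
  · rw [normDist_eq_log_div (isNormOn_Npqj hp hq j)
      (fun x => by simpa using Npqj_mono p h j x)
      (fun x => by
        rw [div_mul_eq_mul_div, div_le_iff₀ h₁, mul_comm _ (1 + q)]
        exact one_add_mul_Npqj_le hp h j x)
      (by simp) (by simp) h_ne h_same,
      one_div_div, Real.log_div h₁.ne' h₂.ne', abs_sub_comm,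
      abs_of_nonneg (sub_nonneg.2 (Real.log_le_log h₂ (by linarith)))]

theorem stmt_11 (k : ℕ) (hk : 2 ≤ k) (p : ℝ≥0∞) (hp : 1 ≤ p) :
    (∀ (q : ℝ), 0 ≤ q → ∀ j : Fin k, IsNormOn (Npqj p q j)) ∧
    (∀ (q q' : ℝ), 0 ≤ q → 0 ≤ q' → ∀ j : Fin k,
      normDist (Npqj p q j) (Npqj p q' j)
        = |Real.log (1 + q') - Real.log (1 + q)|) ∧
    (∀ (q q' : ℝ), 0 ≤ q → 0 ≤ q' → ∀ j j' : Fin k, j ≠ j' →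
      normDist (Npqj p q j) (Npqj p q' j')
        = Real.log (1 + q) + Real.log (1 + q')) :=
  ⟨fun _ hq j => isNormOn_Npqj hp hq j,
    fun _ _ hq hq' j => normDist_Npqj_same hk hp hq hq' j,
    fun _ _ hq hq' _ _ h => normDist_Npqj_of_ne hp hq hq' h⟩
end

section
/- Fix an integer k ≥ 1 and a nonzero vector y ∈ ℝ^k, and define the Euclidean sphere X_y := {x ∈ ℝ^k : ‖x − y‖₂² = 1 + ‖y‖₂²}, where ‖·‖₂ is the Euclidean norm. Then: (a) for every unit vector v ∈ ℝ^k there is a unique α > 0 with α • v ∈ X_y, namely α = √(1 + ⟨v,y⟩²) + ⟨v,y⟩ (so every nonzero vector is a positive multiple of a point of X_y); and (b) no norm N on ℝ^k is constant on X_y, i.e., for every norm N on ℝ^k there exist x, x' ∈ X_y with N(x) ≠ N(x'). -/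
open scoped BigOperators

/-- The Euclidean sphere `X_y = {x : ‖x − y‖₂² = 1 + ‖y‖₂²}`. -/
def sphereXy {k : ℕ} (y : Fin k → ℝ) : Set (Fin k → ℝ) :=
  {x | ∑ i, (x i - y i) ^ 2 = 1 + ∑ i, (y i) ^ 2}

/-- A multiple `t • v` of a unit vector `v` lies on `X_y` iff `t` solves a quadratic equation. -/
theorem smul_mem_sphereXy_iff {k : ℕ} {y v : Fin k → ℝ} (hv : ∑ i, (v i) ^ 2 = 1) (t : ℝ) :
    t • v ∈ sphereXy y ↔ t ^ 2 - 2 * t * (∑ i, v i * y i) = 1 := by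
  have key : ∑ i, ((t • v) i - y i) ^ 2 =
      t ^ 2 - 2 * t * (∑ i, v i * y i) + ∑ i, (y i) ^ 2 := by
    calc ∑ i, ((t • v) i - y i) ^ 2
        = ∑ i, (t ^ 2 * (v i) ^ 2 - 2 * t * (v i * y i) + (y i) ^ 2) := by
          refine Finset.sum_congr rfl fun i _ => ?_
          simp only [Pi.smul_apply, smul_eq_mul]
          ring
      _ = _ := by
          rw [Finset.sum_add_distrib, Finset.sum_sub_distrib, ← Finset.mul_sum, ← Finset.mul_sum,
            hv, mul_one]
  change ∑ i, ((t • v) i - y i) ^ 2 = 1 + ∑ i, (y i) ^ 2 ↔ _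
  rw [key, add_left_inj]

theorem sqrt_one_add_sq_add_pos (c : ℝ) : 0 < Real.sqrt (1 + c ^ 2) + c := by
  have : |c| < Real.sqrt (1 + c ^ 2) := by
    rw [← Real.sqrt_sq_eq_abs]
    exact Real.sqrt_lt_sqrt (sq_nonneg c) (by linarith)
  linarith [neg_abs_le c]

theorem sqrt_smul_mem_sphereXy {k : ℕ} {y v : Fin k → ℝ} (hv : ∑ i, (v i) ^ 2 = 1) :
    (Real.sqrt (1 + (∑ i, v i * y i) ^ 2) + ∑ i, v i * y i) • v ∈ sphereXy y := by
  rw [smul_mem_sphereXy_iff hv]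
  linear_combination Real.sq_sqrt (show 0 ≤ 1 + (∑ i, v i * y i) ^ 2 by positivity)

theorem stmt_13 (k : ℕ) (hk : 1 ≤ k) (y : Fin k → ℝ) (hy : y ≠ 0) :
    (∀ v : Fin k → ℝ, ∑ i, (v i) ^ 2 = 1 →
      (0 < Real.sqrt (1 + (∑ i, v i * y i) ^ 2) + ∑ i, v i * y i) ∧
      (Real.sqrt (1 + (∑ i, v i * y i) ^ 2) + ∑ i, v i * y i) • v ∈ sphereXy y ∧
      (∀ β : ℝ, 0 < β → β • v ∈ sphereXy y →
        β = Real.sqrt (1 + (∑ i, v i * y i) ^ 2) + ∑ i, v i * y i)) ∧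
    (∀ N : (Fin k → ℝ) → ℝ, IsNormOn N →
      ∃ x ∈ sphereXy y, ∃ x' ∈ sphereXy y, N x ≠ N x') := by
  refine ⟨fun v hv => ⟨sqrt_one_add_sq_add_pos _, sqrt_smul_mem_sphereXy hv, fun β hβ hmem => ?_⟩,
    fun N hN => ?_⟩
  · rw [smul_mem_sphereXy_iff hv] at hmem
    set c := ∑ i, v i * y i
    have hpos : 0 < β - c := by nlinarith [sq_nonneg c]
    rw [show 1 + c ^ 2 = (β - c) ^ 2 by linear_combination -hmem, Real.sqrt_sq hpos.le]
    ring
  · obtain ⟨-, hzero, hsmul, -⟩ := hN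
    have hS : 0 < ∑ i, (y i) ^ 2 := by
      obtain ⟨i, hi⟩ := Function.ne_iff.mp hy
      exact Finset.sum_pos' (fun j _ => sq_nonneg _) ⟨i, Finset.mem_univ i, sq_pos_of_ne_zero hi⟩
    set s := Real.sqrt (∑ i, (y i) ^ 2) with hs
    have hs0 : 0 < s := Real.sqrt_pos.mpr hS
    have hs2 : ∑ i, (y i) ^ 2 = s ^ 2 := (Real.sq_sqrt hS.le).symm
    have hv : ∑ i, ((s⁻¹ • y) i) ^ 2 = 1 := by
      simp only [Pi.smul_apply, smul_eq_mul, mul_pow]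
      rw [← Finset.mul_sum, hs2]
      field_simp
    have hc : ∑ i, (s⁻¹ • y) i * y i = s := by
      simp only [Pi.smul_apply, smul_eq_mul, mul_assoc, ← sq]
      rw [← Finset.mul_sum, hs2]
      field_simp
    have hroot := Real.sq_sqrt (show 0 ≤ 1 + s ^ 2 by positivity)
    have hpos := sqrt_one_add_sq_add_pos s
    have hneg := sqrt_one_add_sq_add_pos (-s)
    rw [neg_sq] at hneg
    refine ⟨(Real.sqrt (1 + s ^ 2) + s) • s⁻¹ • y, ?_,
      (-(Real.sqrt (1 + s ^ 2) + -s)) • s⁻¹ • y, ?_, fun h => ?_⟩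
    · rw [smul_mem_sphereXy_iff hv, hc]
      linear_combination hroot
    · rw [smul_mem_sphereXy_iff hv, hc]
      linear_combination hroot
    · rw [hsmul, hsmul _ (s⁻¹ • y), abs_neg, abs_of_pos hpos, abs_of_pos hneg] at h
      have hN0 : N (s⁻¹ • y) = 0 := by
        have : s * N (s⁻¹ • y) = 0 := by linear_combination h / 2
        exact (mul_eq_zero.mp this).resolve_left hs0.ne'
      exact smul_ne_zero (inv_ne_zero hs0.ne') hy ((hzero _).mp hN0)
end

section
/- Fix an integer n ≥ 2. Then d_[n] is a pseudometric on the set of metrics on Fin n: for all metrics ρ, ρ', ρ'' on Fin n one has d_[n](ρ,ρ') ≥ 0, d_[n](ρ,ρ) = 0, d_[n](ρ,ρ') = d_[n](ρ',ρ), and d_[n](ρ,ρ'') ≤ d_[n](ρ,ρ') + d_[n](ρ',ρ''). Moreover, d_[n](ρ,ρ') = 0 if and only if there exists a real number α > 0 with ρ'(x,y) = α·ρ(x,y) for all x, y. -/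
/-- A metric on `Fin n`. -/
def IsMetricOn {n : ℕ} (ρ : Fin n → Fin n → ℝ) : Prop :=
  (∀ x y, ρ x y = 0 ↔ x = y) ∧ (∀ x y, ρ x y = ρ y x) ∧
  (∀ x y z, ρ x z ≤ ρ x y + ρ y z)

/-- The set of ratios `ρ' j k / ρ j k` over distinct `j, k`. -/
def ratioSetFin {n : ℕ} (ρ ρ' : Fin n → Fin n → ℝ) : Set ℝ :=
  {r | ∃ j k : Fin n, j ≠ k ∧ r = ρ' j k / ρ j k}

/-- `d_[n](ρ,ρ') = log max_{j≠k} ρ'(j,k)/ρ(j,k) − log min_{j≠k} ρ'(j,k)/ρ(j,k)`. -/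
noncomputable def metricDist {n : ℕ} (ρ ρ' : Fin n → Fin n → ℝ) : ℝ :=
  Real.log (sSup (ratioSetFin ρ ρ')) - Real.log (sInf (ratioSetFin ρ ρ'))

theorem IsMetricOn.pos {n : ℕ} {ρ : Fin n → Fin n → ℝ} (h : IsMetricOn ρ) {x y : Fin n}
    (hxy : x ≠ y) : 0 < ρ x y := by
  have hne : ρ x y ≠ 0 := fun h0 => hxy ((h.1 x y).1 h0)
  have htri := h.2.2 x y x
  rw [(h.1 x x).2 rfl, h.2.1 y x] at htri
  exact lt_of_le_of_ne (by linarith) hne.symm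

theorem finite_ratioSetFin {n : ℕ} (ρ ρ' : Fin n → Fin n → ℝ) : (ratioSetFin ρ ρ').Finite := by
  refine (Set.finite_range fun p : Fin n × Fin n => ρ' p.1 p.2 / ρ p.1 p.2).subset ?_
  rintro r ⟨j, k, -, rfl⟩
  exact ⟨(j, k), rfl⟩

theorem ratioSetFin_nonempty {n : ℕ} (hn : 2 ≤ n) (ρ ρ' : Fin n → Fin n → ℝ) :
    (ratioSetFin ρ ρ').Nonempty :=
  ⟨_, ⟨0, by omega⟩, ⟨1, by omega⟩, by simp, rfl⟩

/-- The logarithm of the ratio `ρ' j k / ρ j k`, written as a difference. -/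
noncomputable def logRatio {n : ℕ} (ρ ρ' : Fin n → Fin n → ℝ) (j k : Fin n) : ℝ :=
  Real.log (ρ' j k) - Real.log (ρ j k)

theorem IsMetricOn.log_div {n : ℕ} {ρ ρ' : Fin n → Fin n → ℝ} (h : IsMetricOn ρ)
    (h' : IsMetricOn ρ') {j k : Fin n} (hjk : j ≠ k) :
    Real.log (ρ' j k / ρ j k) = logRatio ρ ρ' j k :=
  Real.log_div (h'.pos hjk).ne' (h.pos hjk).ne'

/-- `metricDist ρ ρ'` is attained as a difference of two log-ratios. -/
theorem exists_metricDist_eq {n : ℕ} (hn : 2 ≤ n) {ρ ρ' : Fin n → Fin n → ℝ}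
    (h : IsMetricOn ρ) (h' : IsMetricOn ρ') :
    ∃ a b c d : Fin n, a ≠ b ∧ c ≠ d ∧
      metricDist ρ ρ' = logRatio ρ ρ' a b - logRatio ρ ρ' c d := by
  have hne := ratioSetFin_nonempty hn ρ ρ'
  have hfin := finite_ratioSetFin ρ ρ'
  obtain ⟨a, b, hab, hsup⟩ := hne.csSup_mem hfin
  obtain ⟨c, d, hcd, hinf⟩ := hne.csInf_mem hfin
  refine ⟨a, b, c, d, hab, hcd, ?_⟩
  rw [metricDist, hsup, hinf, h.log_div h' hab, h.log_div h' hcd]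

/-- `metricDist ρ ρ'` bounds every difference of two log-ratios. -/
theorem logRatio_sub_le_metricDist {n : ℕ} {ρ ρ' : Fin n → Fin n → ℝ}
    (h : IsMetricOn ρ) (h' : IsMetricOn ρ') {a b c d : Fin n} (hab : a ≠ b) (hcd : c ≠ d) :
    logRatio ρ ρ' a b - logRatio ρ ρ' c d ≤ metricDist ρ ρ' := by
  have hfin := finite_ratioSetFin ρ ρ'
  have hne : (ratioSetFin ρ ρ').Nonempty := ⟨_, a, b, hab, rfl⟩
  have hinf : 0 < sInf (ratioSetFin ρ ρ') := by
    obtain ⟨j, k, hjk, hr⟩ := hne.csInf_mem hfin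
    rw [hr]
    exact div_pos (h'.pos hjk) (h.pos hjk)
  rw [← h.log_div h' hab, ← h.log_div h' hcd, metricDist]
  exact sub_le_sub
    (Real.log_le_log (div_pos (h'.pos hab) (h.pos hab))
      (le_csSup hfin.bddAbove ⟨a, b, hab, rfl⟩))
    (Real.log_le_log hinf (csInf_le hfin.bddBelow ⟨c, d, hcd, rfl⟩))

theorem metricDist_le_metricDist_swap {n : ℕ} (hn : 2 ≤ n) {ρ ρ' : Fin n → Fin n → ℝ}
    (h : IsMetricOn ρ) (h' : IsMetricOn ρ') : metricDist ρ ρ' ≤ metricDist ρ' ρ := by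
  obtain ⟨a, b, c, d, hab, hcd, he⟩ := exists_metricDist_eq hn h h'
  have := logRatio_sub_le_metricDist h' h hcd hab
  simp only [logRatio] at *
  linarith

theorem metricDist_triangle {n : ℕ} (hn : 2 ≤ n) {ρ ρ' ρ'' : Fin n → Fin n → ℝ}
    (h : IsMetricOn ρ) (h' : IsMetricOn ρ') (h'' : IsMetricOn ρ'') :
    metricDist ρ ρ'' ≤ metricDist ρ ρ' + metricDist ρ' ρ'' := by
  obtain ⟨a, b, c, d, hab, hcd, he⟩ := exists_metricDist_eq hn h h''
  have h1 := logRatio_sub_le_metricDist h h' hab hcd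
  have h2 := logRatio_sub_le_metricDist h' h'' hab hcd
  simp only [logRatio] at *
  linarith

theorem metricDist_eq_zero_of_eq_mul {n : ℕ} (hn : 2 ≤ n) {ρ ρ' : Fin n → Fin n → ℝ}
    (h : IsMetricOn ρ) (h' : IsMetricOn ρ') {α : ℝ} (hα : 0 < α)
    (hmul : ∀ x y, ρ' x y = α * ρ x y) : metricDist ρ ρ' = 0 := by
  have hlog : ∀ {x y : Fin n}, x ≠ y → logRatio ρ ρ' x y = Real.log α := fun {x y} hxy => by
    rw [logRatio, hmul, Real.log_mul hα.ne' (h.pos hxy).ne', add_sub_cancel_right]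
  obtain ⟨a, b, c, d, hab, hcd, he⟩ := exists_metricDist_eq hn h h'
  rw [he, hlog hab, hlog hcd, sub_self]

theorem exists_eq_mul_of_metricDist_eq_zero {n : ℕ} (hn : 2 ≤ n) {ρ ρ' : Fin n → Fin n → ℝ}
    (h : IsMetricOn ρ) (h' : IsMetricOn ρ') (h0 : metricDist ρ ρ' = 0) :
    ∃ α : ℝ, 0 < α ∧ ∀ x y, ρ' x y = α * ρ x y := by
  obtain ⟨a, b, -, -, hab, -, -⟩ := exists_metricDist_eq hn h h'
  have hα : 0 < ρ' a b / ρ a b := div_pos (h'.pos hab) (h.pos hab)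
  refine ⟨ρ' a b / ρ a b, hα, fun x y => ?_⟩
  by_cases hxy : x = y
  · rw [(h.1 x y).2 hxy, (h'.1 x y).2 hxy, mul_zero]
  · have h1 := logRatio_sub_le_metricDist h h' hxy hab
    have h2 := logRatio_sub_le_metricDist h h' hab hxy
    rw [← div_eq_iff (h.pos hxy).ne']
    refine Real.log_injOn_pos (div_pos (h'.pos hxy) (h.pos hxy)) hα ?_
    rw [h.log_div h' hxy, h.log_div h' hab]
    linarith

theorem stmt_14 (n : ℕ) (hn : 2 ≤ n) :
    (∀ ρ ρ' : Fin n → Fin n → ℝ, IsMetricOn ρ → IsMetricOn ρ' →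
      0 ≤ metricDist ρ ρ') ∧
    (∀ ρ : Fin n → Fin n → ℝ, IsMetricOn ρ → metricDist ρ ρ = 0) ∧
    (∀ ρ ρ' : Fin n → Fin n → ℝ, IsMetricOn ρ → IsMetricOn ρ' →
      metricDist ρ ρ' = metricDist ρ' ρ) ∧
    (∀ ρ ρ' ρ'' : Fin n → Fin n → ℝ,
      IsMetricOn ρ → IsMetricOn ρ' → IsMetricOn ρ'' →
      metricDist ρ ρ'' ≤ metricDist ρ ρ' + metricDist ρ' ρ'') ∧
    (∀ ρ ρ' : Fin n → Fin n → ℝ, IsMetricOn ρ → IsMetricOn ρ' →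
      (metricDist ρ ρ' = 0 ↔ ∃ α : ℝ, 0 < α ∧ ∀ x y, ρ' x y = α * ρ x y)) := by
  refine ⟨fun ρ ρ' h h' => ?_, fun ρ h => ?_, fun ρ ρ' h h' => ?_,
    fun ρ ρ' ρ'' h h' h'' => metricDist_triangle hn h h' h'', fun ρ ρ' h h' => ⟨?_, ?_⟩⟩
  · obtain ⟨a, b, -, -, hab, -, -⟩ := exists_metricDist_eq hn h h'
    simpa using logRatio_sub_le_metricDist h h' hab hab
  · exact metricDist_eq_zero_of_eq_mul hn h h one_pos fun x y => (one_mul _).symm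
  · exact le_antisymm (metricDist_le_metricDist_swap hn h h')
      (metricDist_le_metricDist_swap hn h' h)
  · exact exists_eq_mul_of_metricDist_eq_zero hn h h'
  · rintro ⟨α, hα, hmul⟩
    exact metricDist_eq_zero_of_eq_mul hn h h' hα hmul
end

section
/- Let (X, d) be a nonempty finite metric space and let n ≥ 3 be an integer such that the cardinality of X is at most n(n−1)/2. Then there exist a real number α > 0 and a function φ assigning to each x ∈ X a metric φ(x) on Fin n, such that d_[n](φ(x), φ(y)) = α · d(x, y) for all x, y ∈ X. (That is, some rescaling of (X,d) embeds isometrically into the pseudometric space of metrics on Fin n with distance d_[n].) -/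
/-- An embedding of a type with at most `n * (n - 1) / 2` points into the edges of the complete
graph on `Fin n` yields a labelling of edges in which every point occurs. -/
lemma exists_edge_labelling {X : Type*} [Fintype X] [Nonempty X] (n : ℕ)
    (hcard : Fintype.card X ≤ n * (n - 1) / 2) :
    ∃ g : Sym2 (Fin n) → X, ∀ x, ∃ j k : Fin n, j ≠ k ∧ g s(j, k) = x := by
  have hle : Fintype.card X ≤ Fintype.card {a : Sym2 (Fin n) // ¬ a.IsDiag} := by
    rwa [Sym2.card_subtype_not_diag, Fintype.card_fin, Nat.choose_two_right]
  obtain ⟨e⟩ := Function.Embedding.nonempty_of_card_le hle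
  have hinj : Function.Injective fun x => (e x).1 := Subtype.val_injective.comp e.injective
  refine ⟨Function.invFun fun x => (e x).1, fun x => ?_⟩
  obtain ⟨⟨j, k⟩, hjk⟩ : ∃ p : Fin n × Fin n, s(p.1, p.2) = (e x).1 :=
    Sym2.mk_surjective (e x).1 |>.imp fun _ h => h
  refine ⟨j, k, fun h => (e x).2 ?_, ?_⟩
  · rw [← hjk]
    exact Sym2.mk_isDiag_iff.2 h
  · exact (congrArg _ hjk).trans (Function.leftInverse_invFun hinj x)

/-- A symmetric function vanishing exactly on the diagonal, with off-diagonal values in `[1, 2]`,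
is a metric. -/
lemma isMetricOn_of_mem_Icc {n : ℕ} (w : Sym2 (Fin n) → ℝ) (hw : ∀ a, w a ∈ Set.Icc 1 2) :
    IsMetricOn fun j k => if j = k then 0 else w s(j, k) := by
  refine ⟨fun j k => ?_, fun j k => ?_, fun i j k => ?_⟩
  · have := (hw s(j, k)).1
    by_cases h : j = k
    · simp [h]
    · simp only [h, if_false, iff_false]
      linarith
  · simp only [eq_comm, Sym2.eq_swap]
  · have h₁ := hw s(i, j)
    have h₂ := hw s(j, k)
    have h₃ := hw s(i, k)
    simp only [Set.mem_Icc] at h₁ h₂ h₃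
    dsimp only
    split_ifs <;> first | linarith | (subst_vars; first | contradiction | linarith)

/-- Weighting the edges by exponentials of the distances to their labels turns `metricDist` into
twice the scaled distance. -/
lemma metricDist_exp_dist {X : Type*} [MetricSpace X] {n : ℕ} (g : Sym2 (Fin n) → X)
    (hg : ∀ x, ∃ j k : Fin n, j ≠ k ∧ g s(j, k) = x) {s : ℝ} (hs : 0 ≤ s) (x y : X) :
    metricDist (fun j k => if j = k then 0 else Real.exp (s * dist x (g s(j, k))))
      (fun j k => if j = k then 0 else Real.exp (s * dist y (g s(j, k)))) =
      2 * s * dist x y := by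
  have hmax : IsGreatest (ratioSetFin
      (fun j k => if j = k then 0 else Real.exp (s * dist x (g s(j, k))))
      (fun j k => if j = k then 0 else Real.exp (s * dist y (g s(j, k)))))
      (Real.exp (s * dist x y)) := by
    constructor
    · obtain ⟨j, k, hjk, h⟩ := hg x
      exact ⟨j, k, hjk, by simp [hjk, h, dist_comm]⟩
    · rintro _ ⟨j, k, hjk, rfl⟩
      simp only [hjk, if_false, ← Real.exp_sub, ← mul_sub]
      gcongr
      linarith [dist_triangle_left y (g s(j, k)) x]
  have hmin : IsLeast (ratioSetFin
      (fun j k => if j = k then 0 else Real.exp (s * dist x (g s(j, k))))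
      (fun j k => if j = k then 0 else Real.exp (s * dist y (g s(j, k)))))
      (Real.exp (s * -dist x y)) := by
    constructor
    · obtain ⟨j, k, hjk, h⟩ := hg y
      exact ⟨j, k, hjk, by simp [hjk, h, Real.exp_neg]⟩
    · rintro _ ⟨j, k, hjk, rfl⟩
      simp only [hjk, if_false, ← Real.exp_sub, ← mul_sub]
      gcongr
      linarith [dist_triangle x y (g s(j, k))]
  rw [metricDist, hmax.csSup_eq, hmin.csInf_eq, Real.log_exp, Real.log_exp]
  ring

theorem stmt_17 {X : Type*} [MetricSpace X] [Fintype X] [Nonempty X]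
    (n : ℕ) (hn : 3 ≤ n) (hcard : Fintype.card X ≤ n * (n - 1) / 2) :
    ∃ α : ℝ, 0 < α ∧ ∃ φ : X → (Fin n → Fin n → ℝ),
      (∀ x, IsMetricOn (φ x)) ∧
      ∀ x y : X, metricDist (φ x) (φ y) = α * dist x y := by
  obtain ⟨g, hg⟩ := exists_edge_labelling n hcard
  set D := Metric.diam (Set.univ : Set X)
  have hD : 0 ≤ D := Metric.diam_nonneg
  have hdist (x y : X) : dist x y ≤ D :=
    Metric.dist_le_diam_of_mem Set.finite_univ.isBounded (Set.mem_univ x) (Set.mem_univ y)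
  have hlog : 0 < Real.log 2 := Real.log_pos one_lt_two
  set s := Real.log 2 / (D + 1)
  have hs : 0 < s := by positivity
  refine ⟨2 * s, by positivity,
    fun x j k => if j = k then 0 else Real.exp (s * dist x (g s(j, k))),
    fun x => isMetricOn_of_mem_Icc (fun a => Real.exp (s * dist x (g a))) fun a => ⟨?_, ?_⟩,
    metricDist_exp_dist g hg hs.le⟩
  · exact Real.one_le_exp (by positivity)
  · rw [← Real.le_log_iff_exp_le two_pos]
    calc s * dist x (g a) ≤ s * (D + 1) := by gcongr; linarith [hdist x (g a)]
      _ = Real.log 2 := div_mul_cancel₀ _ (by positivity)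
end

section
/- For every integer n ≥ 2 there exists a map Φ from the set of metrics on Fin n to the set of metrics on Fin (n+1) such that d_[n+1](Φ(ρ), Φ(ρ')) = d_[n](ρ, ρ') for all metrics ρ, ρ' on Fin n. (That is, the pseudometric space of metrics on Fin n with distance d_[n] embeds isometrically into that of metrics on Fin (n+1) with distance d_[n+1]; one such map extends a metric ρ by a new point at distance diam(ρ) from every old point.) -/
namespace IsMetricOn

variable {n : ℕ} {ρ : Fin n → Fin n → ℝ}

theorem nonneg (h : IsMetricOn ρ) (x y : Fin n) : 0 ≤ ρ x y := by
  have h₁ := h.2.2 x y x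
  rw [(h.1 x x).2 rfl, h.2.1 y x] at h₁
  linarith

theorem pos_s18 (h : IsMetricOn ρ) {x y : Fin n} (hxy : x ≠ y) : 0 < ρ x y :=
  (h.nonneg x y).lt_of_ne fun h₀ => hxy ((h.1 x y).1 h₀.symm)

end IsMetricOn

/-- The diameter of a distance function on `Fin n`. -/
noncomputable def diamFin {n : ℕ} (ρ : Fin n → Fin n → ℝ) : ℝ :=
  ⨆ p : Fin n × Fin n, ρ p.1 p.2

theorem le_diamFin {n : ℕ} (ρ : Fin n → Fin n → ℝ) (x y : Fin n) : ρ x y ≤ diamFin ρ :=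
  le_ciSup (f := fun p : Fin n × Fin n => ρ p.1 p.2) (Set.finite_range _).bddAbove (x, y)

theorem IsMetricOn.diamFin_pos {n : ℕ} (hn : 2 ≤ n) {ρ : Fin n → Fin n → ℝ}
    (h : IsMetricOn ρ) : 0 < diamFin ρ :=
  (h.pos_s18 (x := ⟨0, by omega⟩) (y := ⟨1, by omega⟩) (by simp)).trans_le (le_diamFin ρ _ _)

theorem IsMetricOn.exists_eq_diamFin {n : ℕ} (hn : 2 ≤ n) {ρ : Fin n → Fin n → ℝ}
    (h : IsMetricOn ρ) : ∃ a b, a ≠ b ∧ ρ a b = diamFin ρ := by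
  have : Nonempty (Fin n) := ⟨⟨0, by omega⟩⟩
  obtain ⟨p, hp⟩ := exists_eq_ciSup_of_finite (f := fun p : Fin n × Fin n => ρ p.1 p.2)
  refine ⟨p.1, p.2, fun hab => ?_, hp⟩
  have h₀ : ρ p.1 p.2 = diamFin ρ := hp
  exact (h.diamFin_pos hn).ne (((h.1 _ _).2 hab).symm.trans h₀)

/-- Extend a distance function by a new point at distance `diamFin ρ` from every old point. -/
noncomputable def extendByDiam {n : ℕ} (ρ : Fin n → Fin n → ℝ) :
    Fin (n + 1) → Fin (n + 1) → ℝ := fun x y =>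
  Fin.lastCases (motive := fun _ => ℝ)
    (Fin.lastCases (motive := fun _ => ℝ) 0 (fun _ => diamFin ρ) y)
    (fun i => Fin.lastCases (motive := fun _ => ℝ) (diamFin ρ) (fun j => ρ i j) y) x

section extendByDiam

variable {n : ℕ} (ρ : Fin n → Fin n → ℝ) (i j : Fin n)

@[simp] theorem extendByDiam_castSucc_castSucc :
    extendByDiam ρ i.castSucc j.castSucc = ρ i j := by simp [extendByDiam]

@[simp] theorem extendByDiam_castSucc_last :
    extendByDiam ρ i.castSucc (Fin.last n) = diamFin ρ := by simp [extendByDiam]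

@[simp] theorem extendByDiam_last_castSucc :
    extendByDiam ρ (Fin.last n) j.castSucc = diamFin ρ := by simp [extendByDiam]

@[simp] theorem extendByDiam_last_last :
    extendByDiam ρ (Fin.last n) (Fin.last n) = 0 := by simp [extendByDiam]

end extendByDiam

theorem IsMetricOn.extendByDiam {n : ℕ} (hn : 2 ≤ n) {ρ : Fin n → Fin n → ℝ}
    (h : IsMetricOn ρ) : IsMetricOn (extendByDiam ρ) := by
  have hD := h.diamFin_pos hn
  refine ⟨fun x y => ?_, fun x y => ?_, fun x y z => ?_⟩
  · induction x using Fin.lastCases <;> induction y using Fin.lastCases <;>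
      simp [hD.ne', h.1, Fin.castSucc_ne_last, (Fin.castSucc_ne_last _).symm]
  · induction x using Fin.lastCases <;> induction y using Fin.lastCases <;> simp [h.2.1]
  · induction x using Fin.lastCases with
    | last =>
      induction y using Fin.lastCases <;> induction z using Fin.lastCases <;>
        simp [hD.le, h.nonneg]
    | cast i =>
      induction y using Fin.lastCases with
      | last =>
        induction z using Fin.lastCases with
        | last => simp
        | cast k =>
          simp only [extendByDiam_castSucc_castSucc, extendByDiam_castSucc_last,
            extendByDiam_last_castSucc]
          linarith [le_diamFin ρ i k]
      | cast j => induction z using Fin.lastCases <;> simp [h.nonneg, h.2.2]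

theorem ratioSetFin_extendByDiam {n : ℕ} (hn : 2 ≤ n) (ρ ρ' : Fin n → Fin n → ℝ) :
    ratioSetFin (extendByDiam ρ) (extendByDiam ρ') =
      insert (diamFin ρ' / diamFin ρ) (ratioSetFin ρ ρ') := by
  ext r
  constructor
  · rintro ⟨x, y, hxy, rfl⟩
    induction x using Fin.lastCases with
    | last =>
      induction y using Fin.lastCases with
      | last => exact absurd rfl hxy
      | cast j => left; simp
    | cast i =>
      induction y using Fin.lastCases with
      | last => left; simp
      | cast j => exact Or.inr ⟨i, j, fun hij => hxy (by rw [hij]), by simp⟩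
  · rintro (rfl | ⟨i, j, hij, rfl⟩)
    · exact ⟨Fin.castSucc ⟨0, by omega⟩, Fin.last n, Fin.castSucc_ne_last _, by
        simp only [extendByDiam_castSucc_last]⟩
    · exact ⟨i.castSucc, j.castSucc, fun h => hij (Fin.castSucc_injective n h), by simp⟩

theorem metricDist_extendByDiam {n : ℕ} (hn : 2 ≤ n) {ρ ρ' : Fin n → Fin n → ℝ}
    (h : IsMetricOn ρ) (h' : IsMetricOn ρ') :
    metricDist (extendByDiam ρ) (extendByDiam ρ') = metricDist ρ ρ' := by
  obtain ⟨a, b, hab, hD⟩ := h.exists_eq_diamFin hn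
  obtain ⟨c, d, hcd, hD'⟩ := h'.exists_eq_diamFin hn
  have hfin := finite_ratioSetFin ρ ρ'
  have hne : (ratioSetFin ρ ρ').Nonempty := ⟨_, a, b, hab, rfl⟩
  have hle : diamFin ρ' / diamFin ρ ≤ sSup (ratioSetFin ρ ρ') := by
    refine le_trans ?_ (le_csSup hfin.bddAbove ⟨c, d, hcd, rfl⟩)
    rw [hD']
    exact div_le_div_of_nonneg_left (h'.diamFin_pos hn).le (h.pos_s18 hcd) (le_diamFin ρ c d)
  have hge : sInf (ratioSetFin ρ ρ') ≤ diamFin ρ' / diamFin ρ := by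
    refine le_trans (csInf_le hfin.bddBelow ⟨a, b, hab, rfl⟩) ?_
    rw [hD]
    exact div_le_div_of_nonneg_right (le_diamFin ρ' a b) (h.diamFin_pos hn).le
  rw [metricDist, metricDist, ratioSetFin_extendByDiam hn, csSup_insert hfin.bddAbove hne,
    csInf_insert hfin.bddBelow hne, sup_eq_right.2 hle, inf_eq_right.2 hge]

theorem stmt_18 (n : ℕ) (hn : 2 ≤ n) :
    ∃ Φ : (Fin n → Fin n → ℝ) → (Fin (n + 1) → Fin (n + 1) → ℝ),
      (∀ ρ : Fin n → Fin n → ℝ, IsMetricOn ρ → IsMetricOn (Φ ρ)) ∧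
      (∀ ρ ρ' : Fin n → Fin n → ℝ, IsMetricOn ρ → IsMetricOn ρ' →
        metricDist (Φ ρ) (Φ ρ') = metricDist ρ ρ') :=
  ⟨extendByDiam, fun _ h => h.extendByDiam hn, fun _ _ h h' => metricDist_extendByDiam hn h h'⟩
end

section
/- Let (X, d) be a finite metric space with at least 3 points. (a) If the diameter of X is at most log 2, then for every x ∈ X and all values w₁, w₂, w₃ belonging to the set {0} ∪ {d(x', x) : x' ∈ X}, one has exp(w₁) + exp(w₂) ≥ exp(w₃); consequently the zero-padded Fréchet tuples (d(x₀,x), …, d(x_{m−1},x), 0, …, 0) ∈ ℝ^{n(n−1)/2} satisfy the exponentiated triangle inequalities defining the logarithms of metrics on Fin n, whenever |X| = m ≤ n(n−1)/2. (b) Conversely, if X has exactly 3 points and for every x ∈ X and all w₁, w₂, w₃ ∈ {0} ∪ {d(x', x) : x' ∈ X} one has exp(w₁) + exp(w₂) ≥ exp(w₃), then the diameter of X is at most log 2. -/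
theorem Real.exp_le_exp_add_exp_of_le_log_two {u v w : ℝ} (hu : 0 ≤ u) (hv : 0 ≤ v)
    (hw : w ≤ Real.log 2) : Real.exp w ≤ Real.exp u + Real.exp v := by
  have h : Real.exp w ≤ 2 := (Real.le_log_iff_exp_le two_pos).mp hw
  linarith [Real.one_le_exp hu, Real.one_le_exp hv]


theorem stmt_19 {X : Type*} [MetricSpace X] [Fintype X]
    (h3 : 3 ≤ Fintype.card X) :
    -- (a) if diam X ≤ log 2 then the exponentiated triangle inequalities hold
    (Metric.diam (Set.univ : Set X) ≤ Real.log 2 →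
      (∀ x : X,
        ∀ w₁ ∈ insert (0 : ℝ) {w : ℝ | ∃ x' : X, w = dist x' x},
        ∀ w₂ ∈ insert (0 : ℝ) {w : ℝ | ∃ x' : X, w = dist x' x},
        ∀ w₃ ∈ insert (0 : ℝ) {w : ℝ | ∃ x' : X, w = dist x' x},
          Real.exp w₃ ≤ Real.exp w₁ + Real.exp w₂) ∧
      -- consequently: the zero-padded Fréchet tuples in `ℝ^{n(n-1)/2}` satisfy
      -- the exponentiated triangle inequalities defining logarithms of metrics
      -- on `Fin n`, whenever `|X| = m ≤ n(n-1)/2`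
      (∀ n m : ℕ, Fintype.card X = m → m ≤ n * (n - 1) / 2 →
        ∀ e : Fin m ≃ X, ∀ x : X,
          ∀ a b c : Fin (n * (n - 1) / 2),
            Real.exp ((fun i : Fin (n * (n - 1) / 2) =>
                if h : (i : ℕ) < m then dist (e ⟨i, h⟩) x else 0) c)
              ≤ Real.exp ((fun i : Fin (n * (n - 1) / 2) =>
                  if h : (i : ℕ) < m then dist (e ⟨i, h⟩) x else 0) a)
                + Real.exp ((fun i : Fin (n * (n - 1) / 2) =>
                    if h : (i : ℕ) < m then dist (e ⟨i, h⟩) x else 0) b))) ∧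
    -- (b) converse for three-point spaces
    (Fintype.card X = 3 →
      (∀ x : X,
        ∀ w₁ ∈ insert (0 : ℝ) {w : ℝ | ∃ x' : X, w = dist x' x},
        ∀ w₂ ∈ insert (0 : ℝ) {w : ℝ | ∃ x' : X, w = dist x' x},
        ∀ w₃ ∈ insert (0 : ℝ) {w : ℝ | ∃ x' : X, w = dist x' x},
          Real.exp w₃ ≤ Real.exp w₁ + Real.exp w₂) →
      Metric.diam (Set.univ : Set X) ≤ Real.log 2) := by
  have log_two_nonneg : 0 ≤ Real.log 2 := Real.log_nonneg one_le_two
  refine ⟨fun hdiam => ?_, fun _ hexp => ?_⟩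
  · have dist_le (y z : X) : dist y z ≤ Real.log 2 :=
      (Metric.dist_le_diam_of_mem Set.finite_univ.isBounded
        (Set.mem_univ y) (Set.mem_univ z)).trans hdiam
    refine ⟨fun x => ?_, fun n m _ _ e x a b c => ?_⟩
    · have bounds : ∀ w ∈ insert (0 : ℝ) {w : ℝ | ∃ x' : X, w = dist x' x},
          0 ≤ w ∧ w ≤ Real.log 2 := by
        rintro w (rfl | ⟨y, rfl⟩)
        · exact ⟨le_rfl, log_two_nonneg⟩
        · exact ⟨dist_nonneg, dist_le y x⟩
      exact fun u hu v hv w hw => Real.exp_le_exp_add_exp_of_le_log_two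
        (bounds u hu).1 (bounds v hv).1 (bounds w hw).2
    · have bounds (i : Fin (n * (n - 1) / 2)) :
          0 ≤ (if h : (i : ℕ) < m then dist (e ⟨i, h⟩) x else 0) ∧
            (if h : (i : ℕ) < m then dist (e ⟨i, h⟩) x else 0) ≤ Real.log 2 := by
        split_ifs
        · exact ⟨dist_nonneg, dist_le _ x⟩
        · exact ⟨le_rfl, log_two_nonneg⟩
      exact Real.exp_le_exp_add_exp_of_le_log_two (bounds a).1 (bounds b).1 (bounds c).2
  · refine Metric.diam_le_of_forall_dist_le log_two_nonneg fun y _ z _ => ?_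
    have h := hexp z 0 (Or.inl rfl) 0 (Or.inl rfl) (dist y z) (Or.inr ⟨y, rfl⟩)
    rw [Real.exp_zero, one_add_one_eq_two] at h
    exact (Real.le_log_iff_exp_le two_pos).mpr h
end
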